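/- Let q not be a root of unity, let N ∈ ℕ, and let μ, j1, j2, j3 ∈ ℂ with ν := −μ − 1 + (j1+j2+j3)/2 satisfy: q^{2μ} ≠ −q^l and q^{2ν} ≠ −q^l for every integer l with −1 ≤ l ≤ 2N+1; one of the numbers q^{j1}, q^{j2}, q^{j3} equals q^{N+1}; none of Λ_{j1}, Λ_{j2}, Λ_{j3} equals Λ_k for any k ∈ {1,…,N}, and the same holds with μ replaced by ν throughout. Let M_A be the (N+1)×(N+1) complex matrix whose k-th column has entry C_k in row k−1, entry −(A_k + C_k − 1 + q^{−2ν}) in row k, and entry A_k in row k+1 (k = 0,…,N), and let M_B := diag(q^{−k} − q^{−2μ+k})_{k=0}^{N}. Then there exists an invertible (N+1)×(N+1) complex matrix P such that P^{−1} M_A P = diag(q^{−k} − q^{−2ν+k})_{k=0}^{N} and P^{−1} M_B P is the matrix whose k-th column has entry D_k in row k−1, entry −(B_k + D_k − 1 + q^{−2μ}) in row k, and entry B_k in row k+1. In particular (M_A, M_B) is a Leonard pair. -/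

import Mathlib

noncomputable section

/-- `q^λ := exp (λ·L)`, where `L` is a fixed logarithm of `q` (so `q = exp L` and the
fixed square root is `q^{1/2} = exp (L/2) = qp L (1/2)`). -/
def qp (L lam : ℂ) : ℂ := Complex.exp (lam * L)

/-- The `q`-number `[λ]_q = (q^λ − q^{−λ})/(q − q⁻¹)`. -/
def qn (L lam : ℂ) : ℂ :=
  (qp L lam - qp L (-lam)) / (Complex.exp L - (Complex.exp L)⁻¹)

/-- `Λ_j := [μ−j+1]_q + [μ−j]_q`. -/
def LamF (L μ j : ℂ) : ℂ := qn L (μ - j + 1) + qn L (μ - j)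

/-- The coefficient `A_n` (for the parameter `μ`; `B_n` is obtained by substituting
`ν` for `μ`). -/
def Afn (L μ j1 j2 j3 n : ℂ) : ℂ :=
  ((1 - qp L (n - j1 + 1)) * (1 - qp L (n - j2 + 1)) * (1 - qp L (n - j3 + 1)) *
      (1 + qp L (-2 * μ + n))) /
    ((1 + qp L (-2 * μ + 2 * n)) * (1 + qp L (-2 * μ + 2 * n + 1)))

/-- The coefficient `C_n` (for the parameter `μ`; `D_n` is obtained by substituting
`ν` for `μ`, the prefactor becoming `−q^{−2μ} = −q^{2ν+2−j1−j2−j3}`). -/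
def Cfn (L μ j1 j2 j3 n : ℂ) : ℂ :=
  (-(qp L (2 * μ + 2 - j1 - j2 - j3)) * (1 - qp L n) * (1 + qp L (-2 * μ - 1 + n + j1)) *
      (1 + qp L (-2 * μ - 1 + n + j2)) * (1 + qp L (-2 * μ - 1 + n + j3))) /
    ((1 + qp L (-2 * μ + 2 * n - 1)) * (1 + qp L (-2 * μ + 2 * n)))

/-- The tridiagonal matrix whose `k`-th column has `C_k` in row `k−1`,
`−(A_k + C_k − 1 + q^{−2ν})` in row `k` and `A_k` in row `k+1`, where the coefficients
`A, C` are taken at the parameter `μ` and the diagonal constant is `q^{−2ν}`. -/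
def triMat (L μ ν j1 j2 j3 : ℂ) (N : ℕ) : Matrix (Fin (N + 1)) (Fin (N + 1)) ℂ :=
  fun i k =>
    if (i : ℕ) + 1 = (k : ℕ) then Cfn L μ j1 j2 j3 ((k : ℕ) : ℂ)
    else if (i : ℕ) = (k : ℕ) then
      -(Afn L μ j1 j2 j3 ((k : ℕ) : ℂ) + Cfn L μ j1 j2 j3 ((k : ℕ) : ℂ) - 1
          + qp L (-2 * ν))
    else if (i : ℕ) = (k : ℕ) + 1 then Afn L μ j1 j2 j3 ((k : ℕ) : ℂ)
    else 0

/-- The product `(Q⁻¹; q)_i (a Q; q)_i` of `q`-shifted factorials. -/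
def qRacahFactor (q a Q : ℂ) (i : ℕ) : ℂ :=
  ∏ h ∈ Finset.range i, (1 - q ^ h / Q) * (1 - a * Q * q ^ h)

/-- The product `q^{-i} (q, t₁, t₂, t₃; q)_i`. -/
def qRacahDenom (q t₁ t₂ t₃ : ℂ) (i : ℕ) : ℂ :=
  ∏ h ∈ Finset.range i,
    (1 - q * q ^ h) * (1 - t₁ * q ^ h) * (1 - t₂ * q ^ h) * (1 - t₃ * q ^ h) / q

/-- The `q`-Racah function, a `₄φ₃` series truncated at degree `N`. -/
def qRacah (q a c t₁ t₂ t₃ : ℂ) (N : ℕ) (Q X : ℂ) : ℂ :=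
  ∑ i ∈ Finset.range (N + 1),
    qRacahFactor q a Q i * qRacahFactor q c X i / qRacahDenom q t₁ t₂ t₃ i

/-- The raising coefficient of the `q`-Racah recurrence. -/
def qRacahUp (q a t₁ t₂ t₃ Q : ℂ) : ℂ :=
  (1 - t₁ * Q) * (1 - t₂ * Q) * (1 - t₃ * Q) * (1 - a * Q) /
    ((1 - a * Q ^ 2) * (1 - a * Q ^ 2 * q))

/-- The lowering coefficient of the `q`-Racah recurrence. -/
def qRacahDown (q a c t₁ t₂ t₃ Q : ℂ) : ℂ :=
  c * (1 - Q) * (1 - a * Q / t₁) * (1 - a * Q / t₂) * (1 - a * Q / t₃) /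
    ((1 - a * Q ^ 2 / q) * (1 - a * Q ^ 2))

lemma qRacahFactor_succ (q a Q : ℂ) (i : ℕ) :
    qRacahFactor q a Q (i + 1) =
      qRacahFactor q a Q i * ((1 - q ^ i / Q) * (1 - a * Q * q ^ i)) :=
  Finset.prod_range_succ _ _

lemma qRacahDenom_succ (q t₁ t₂ t₃ : ℂ) (i : ℕ) :
    qRacahDenom q t₁ t₂ t₃ (i + 1) = qRacahDenom q t₁ t₂ t₃ i *
      ((1 - q * q ^ i) * (1 - t₁ * q ^ i) * (1 - t₂ * q ^ i) * (1 - t₃ * q ^ i) / q) :=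
  Finset.prod_range_succ _ _

lemma qRacahFactor_shift_up {q a Q : ℂ} (hq : q ≠ 0) (hQ : Q ≠ 0) (i : ℕ) :
    (1 - a * Q) * qRacahFactor q a (Q * q) (i + 1) =
      (1 - 1 / (Q * q)) * (1 - a * Q * q ^ i) * (1 - a * Q * (q * q ^ i)) *
        qRacahFactor q a Q i := by
  induction i with
  | zero => simp [qRacahFactor]; ring
  | succ i ih =>
    rw [qRacahFactor_succ, ← mul_assoc, ih, qRacahFactor_succ]
    have : q ^ (i + 1) / (Q * q) = q ^ i / Q := by rw [pow_succ]; field_simp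
    rw [this]
    ring

lemma qRacahFactor_shift_down {q a Q : ℂ} (hq : q ≠ 0) (hQ : Q ≠ 0) (i : ℕ) :
    (1 - Q) * qRacahFactor q a (Q / q) (i + 1) =
      -Q * (1 - q ^ i / Q) * (1 - q * q ^ i / Q) * (1 - a * Q / q) *
        qRacahFactor q a Q i := by
  induction i with
  | zero => simp [qRacahFactor]; field_simp; ring
  | succ i ih =>
    rw [qRacahFactor_succ, ← mul_assoc, ih, qRacahFactor_succ]
    have h₁ : q ^ (i + 1) / (Q / q) = q * q ^ (i + 1) / Q := by field_simp
    have h₂ : a * (Q / q) * q ^ (i + 1) = a * Q * q ^ i := by rw [pow_succ']; field_simp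
    rw [h₁, h₂]
    ring

lemma qRacah_rational_identity {q a c t₁ t₂ t₃ Q X : ℂ} (hq : q ≠ 0) (hQ : Q ≠ 0) (hX : X ≠ 0)
    (ha : a ≠ 0) (h₁ : t₁ ≠ 0) (h₂ : t₂ ≠ 0) (h₃ : t₃ ≠ 0)
    (hc : c = t₁ * t₂ * t₃ / (a * q))
    (hd₀ : q - a * Q ^ 2 ≠ 0) (hd₁ : 1 - a * Q ^ 2 ≠ 0) (hd₂ : 1 - a * Q ^ 2 * q ≠ 0) :
    (1 - t₁ * Q) * (1 - t₂ * Q) * (1 - t₃ * Q) / ((1 - a * Q ^ 2) * (1 - a * Q ^ 2 * q)) *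
        ((1 - 1 / (Q * q)) * (1 - a * Q * X) * (1 - a * Q * (q * X))) -
      (qRacahUp q a t₁ t₂ t₃ Q + qRacahDown q a c t₁ t₂ t₃ Q - 1 - c) *
        ((1 - X / Q) * (1 - a * Q * X)) +
      c * (1 - a * Q / t₁) * (1 - a * Q / t₂) * (1 - a * Q / t₃) /
          ((1 - a * Q ^ 2 / q) * (1 - a * Q ^ 2)) *
        (-Q * (1 - X / Q) * (1 - q * X / Q) * (1 - a * Q / q)) =
      (1 / (q * X) + c * (q * X)) * ((1 - X / Q) * (1 - a * Q * X)) -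
        1 / X * ((1 - q * X) * (1 - t₁ * X) * (1 - t₂ * X) * (1 - t₃ * X) / q) := by
  have e : 1 - a * Q ^ 2 / q = (q - a * Q ^ 2) / q := one_sub_div hq
  subst hc
  unfold qRacahUp qRacahDown
  rw [e]
  generalize hD₀ : q - a * Q ^ 2 = D₀ at *
  generalize hD₁ : 1 - a * Q ^ 2 = D₁ at *
  generalize hD₂ : 1 - a * Q ^ 2 * q = D₂ at *
  field_simp
  rw [← hD₀, ← hD₁, ← hD₂]
  ring

lemma qRacahFactor_recurrence {q a c t₁ t₂ t₃ Q : ℂ} (hq : q ≠ 0) (hQ : Q ≠ 0)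
    (ha : a ≠ 0) (h₁ : t₁ ≠ 0) (h₂ : t₂ ≠ 0) (h₃ : t₃ ≠ 0)
    (hc : c = t₁ * t₂ * t₃ / (a * q))
    (hd₀ : q - a * Q ^ 2 ≠ 0) (hd₁ : 1 - a * Q ^ 2 ≠ 0) (hd₂ : 1 - a * Q ^ 2 * q ≠ 0) (i : ℕ) :
    qRacahUp q a t₁ t₂ t₃ Q * qRacahFactor q a (Q * q) (i + 1) -
      (qRacahUp q a t₁ t₂ t₃ Q + qRacahDown q a c t₁ t₂ t₃ Q - 1 - c) *
        qRacahFactor q a Q (i + 1) +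
      qRacahDown q a c t₁ t₂ t₃ Q * qRacahFactor q a (Q / q) (i + 1) =
      (1 / q ^ (i + 1) + c * q ^ (i + 1)) * qRacahFactor q a Q (i + 1) -
        1 / q ^ i * qRacahFactor q a Q i *
          ((1 - q * q ^ i) * (1 - t₁ * q ^ i) * (1 - t₂ * q ^ i) * (1 - t₃ * q ^ i) / q) := by
  have hup : qRacahUp q a t₁ t₂ t₃ Q * qRacahFactor q a (Q * q) (i + 1) =
      (1 - t₁ * Q) * (1 - t₂ * Q) * (1 - t₃ * Q) / ((1 - a * Q ^ 2) * (1 - a * Q ^ 2 * q)) *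
        ((1 - a * Q) * qRacahFactor q a (Q * q) (i + 1)) := by
    unfold qRacahUp; ring
  have hdown : qRacahDown q a c t₁ t₂ t₃ Q * qRacahFactor q a (Q / q) (i + 1) =
      c * (1 - a * Q / t₁) * (1 - a * Q / t₂) * (1 - a * Q / t₃) /
          ((1 - a * Q ^ 2 / q) * (1 - a * Q ^ 2)) *
        ((1 - Q) * qRacahFactor q a (Q / q) (i + 1)) := by
    unfold qRacahDown; ring
  rw [hup, hdown, qRacahFactor_shift_up hq hQ, qRacahFactor_shift_down hq hQ,
    qRacahFactor_succ, pow_succ']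
  linear_combination qRacahFactor q a Q i *
    qRacah_rational_identity hq hQ (pow_ne_zero i hq) ha h₁ h₂ h₃ hc hd₀ hd₁ hd₂

/-- The recurrence of the truncated `q`-Racah function, with the error due to truncation. -/
lemma qRacah_recurrence_truncated {q a c t₁ t₂ t₃ Q X : ℂ} (hq : q ≠ 0) (hQ : Q ≠ 0)
    (hX : X ≠ 0) (ha : a ≠ 0) (h₁ : t₁ ≠ 0) (h₂ : t₂ ≠ 0) (h₃ : t₃ ≠ 0)
    (hc : c = t₁ * t₂ * t₃ / (a * q))
    (hd₀ : q - a * Q ^ 2 ≠ 0) (hd₁ : 1 - a * Q ^ 2 ≠ 0) (hd₂ : 1 - a * Q ^ 2 * q ≠ 0) (N : ℕ)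
    (hN : qRacahDenom q t₁ t₂ t₃ N ≠ 0) :
    qRacahUp q a t₁ t₂ t₃ Q * qRacah q a c t₁ t₂ t₃ N (Q * q) X -
      (qRacahUp q a t₁ t₂ t₃ Q + qRacahDown q a c t₁ t₂ t₃ Q - 1 - c) *
        qRacah q a c t₁ t₂ t₃ N Q X +
      qRacahDown q a c t₁ t₂ t₃ Q * qRacah q a c t₁ t₂ t₃ N (Q / q) X =
      (1 / X + c * X) * qRacah q a c t₁ t₂ t₃ N Q X +
        qRacahFactor q a Q N * qRacahFactor q c X (N + 1) /
          (q ^ N * qRacahDenom q t₁ t₂ t₃ N) := by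
  induction N with
  | zero =>
    simp only [qRacah, qRacahFactor, qRacahDenom, Finset.range_zero, Finset.prod_empty, zero_add,
      Finset.sum_range_one, Finset.prod_range_one, pow_zero]
    field_simp
    ring
  | succ N ih =>
    rw [qRacahDenom_succ] at hN
    have hN₀ := left_ne_zero_of_mul hN
    have hN₁ := right_ne_zero_of_mul hN
    have step := qRacahFactor_recurrence hq hQ ha h₁ h₂ h₃ hc hd₀ hd₁ hd₂ N
    have ih := ih hN₀
    have hs : ∀ Q, qRacah q a c t₁ t₂ t₃ (N + 1) Q X = qRacah q a c t₁ t₂ t₃ N Q X +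
        qRacahFactor q a Q (N + 1) * qRacahFactor q c X (N + 1) /
          qRacahDenom q t₁ t₂ t₃ (N + 1) := fun Q => Finset.sum_range_succ _ _
    rw [hs, hs, hs, qRacahDenom_succ, qRacahFactor_succ q c X (N + 1)]
    generalize (1 - q * q ^ N) * (1 - t₁ * q ^ N) * (1 - t₂ * q ^ N) * (1 - t₃ * q ^ N) / q = δ at *
    generalize qRacahUp q a t₁ t₂ t₃ Q = A at *
    generalize qRacahDown q a c t₁ t₂ t₃ Q = C at *
    generalize qRacahDenom q t₁ t₂ t₃ N = d at *
    generalize qRacahFactor q c X (N + 1) = b at *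
    generalize qRacahFactor q a Q (N + 1) = f at *
    generalize qRacahFactor q a Q N = f₀ at *
    generalize hp : q ^ (N + 1) = p at *
    have hp0 : p ≠ 0 := hp ▸ pow_ne_zero _ hq
    have e₁ : f₀ * b / (q ^ N * d) = 1 / q ^ N * f₀ * δ * (b / (d * δ)) := by
      field_simp
    have e₂ : f * (b * ((1 - p / X) * (1 - c * X * p))) / (p * (d * δ)) =
        (1 / p + c * p - 1 / X - c * X) * f * (b / (d * δ)) := by
      field_simp
      ring
    rw [e₁] at ih
    rw [e₂]
    linear_combination ih + b / (d * δ) * step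

lemma qRacah_comm (q a c t₁ t₂ t₃ : ℂ) (N : ℕ) (Q X : ℂ) :
    qRacah q a c t₁ t₂ t₃ N Q X = qRacah q c a t₁ t₂ t₃ N X Q :=
  Finset.sum_congr rfl fun i _ => by rw [mul_comm (qRacahFactor q a Q i)]

lemma qRacahFactor_pow_eq_zero {q : ℂ} (hq : q ≠ 0) (a : ℂ) {x i : ℕ} (hx : x < i) :
    qRacahFactor q a (q ^ x) i = 0 :=
  Finset.prod_eq_zero (Finset.mem_range.2 hx) (by simp [pow_ne_zero x hq])

lemma qRacah_one_left {q : ℂ} (a c t₁ t₂ t₃ : ℂ) (N : ℕ) (X : ℂ) :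
    qRacah q a c t₁ t₂ t₃ N 1 X = 1 := by
  rw [qRacah, Finset.sum_range_succ', Finset.sum_eq_zero]
  · simp [qRacahFactor, qRacahDenom]
  · intro i _
    have : qRacahFactor q a 1 (i + 1) = 0 :=
      Finset.prod_eq_zero (Finset.mem_range.2 i.succ_pos) (by simp)
    simp [this]

lemma qp_add (L x y : ℂ) : qp L (x + y) = qp L x * qp L y := by
  simp [qp, add_mul, Complex.exp_add]

lemma qp_ne_zero (L x : ℂ) : qp L x ≠ 0 := Complex.exp_ne_zero _

lemma qp_neg (L x : ℂ) : qp L (-x) = (qp L x)⁻¹ := by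
  simp [qp, Complex.exp_neg]

lemma qp_sub (L x y : ℂ) : qp L (x - y) = qp L x / qp L y := by
  rw [sub_eq_add_neg, qp_add, qp_neg, div_eq_mul_inv]

lemma qp_one (L : ℂ) : qp L 1 = Complex.exp L := by simp [qp]

lemma qp_natCast (L : ℂ) (n : ℕ) : qp L n = Complex.exp L ^ n := by
  rw [qp, Complex.exp_nat_mul]

lemma qp_two_mul (L x : ℂ) : qp L (2 * x) = qp L x ^ 2 := by
  rw [two_mul, qp_add, sq]

lemma LamF_congr {L μ j k : ℂ} (h : qp L j = qp L k) : LamF L μ j = LamF L μ k := by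
  simp only [LamF, qn, qp_add, qp_sub, qp_neg, h]

lemma LamF_eq_of_qp_eq_neg_one {L μ j k : ℂ} (h : qp L (-2 * μ - 1 + k + j) = -1) :
    LamF L μ j = LamF L μ k := by
  have key : ∀ x y : ℂ, x = y + (-2 * μ - 1 + k + j) → qp L x = -qp L y := by
    rintro x y rfl
    rw [qp_add, h, mul_neg_one]
  have e₁ := key (-(μ - k)) (μ - j + 1) (by ring)
  have e₂ := key (-(μ - k + 1)) (μ - j) (by ring)
  have e₃ := key (-(μ - j)) (μ - k + 1) (by ring)
  have e₄ := key (-(μ - j + 1)) (μ - k) (by ring)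
  simp only [LamF, qn, ← add_div]
  rw [e₁, e₂, e₃, e₄]
  ring

lemma Afn_eq_qRacahUp (L μ j1 j2 j3 : ℂ) (n : ℕ) :
    Afn L μ j1 j2 j3 n =
      qRacahUp (Complex.exp L) (-qp L (-2 * μ)) (qp L (1 - j1)) (qp L (1 - j2)) (qp L (1 - j3))
        (Complex.exp L ^ n) := by
  have e : ∀ j : ℂ, qp L ((n : ℂ) - j + 1) = qp L (1 - j) * Complex.exp L ^ n := fun j => by
    rw [← qp_natCast, ← qp_add]; congr 1; ring
  simp only [Afn, qRacahUp, e, qp_add, qp_natCast, qp_two_mul L (n : ℂ), qp_one]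
  ring

lemma Cfn_eq_qRacahDown {L μ ν j1 j2 j3 : ℂ} (hν : ν = -μ - 1 + (j1 + j2 + j3) / 2) (n : ℕ) :
    Cfn L μ j1 j2 j3 n =
      qRacahDown (Complex.exp L) (-qp L (-2 * μ)) (-qp L (-2 * ν))
        (qp L (1 - j1)) (qp L (1 - j2)) (qp L (1 - j3)) (Complex.exp L ^ n) := by
  have e : ∀ j : ℂ, 1 + qp L (-2 * μ - 1 + n + j) =
      1 - -qp L (-2 * μ) * Complex.exp L ^ n / qp L (1 - j) := fun j => by
    rw [← qp_natCast, neg_mul (qp L (-2 * μ)), neg_div, sub_neg_eq_add, ← qp_add, ← qp_sub]; congr 2; ring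
  have e' : 2 * μ + 2 - j1 - j2 - j3 = -2 * ν := by rw [hν]; ring
  have e₂ : 1 + qp L (-2 * μ + 2 * n - 1) =
      1 - -qp L (-2 * μ) * (Complex.exp L ^ n) ^ 2 / Complex.exp L := by
    rw [qp_sub, qp_add, qp_two_mul, qp_natCast, qp_one]; ring
  have e₃ : 1 + qp L (-2 * μ + 2 * n) =
      1 - -qp L (-2 * μ) * (Complex.exp L ^ n) ^ 2 := by
    rw [qp_add, qp_two_mul, qp_natCast]; ring
  rw [Cfn, qRacahDown, e, e, e, e', e₂, e₃, qp_natCast]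

lemma sum_mul_triMat {L μ ν j1 j2 j3 : ℂ} {N : ℕ} (hA : Afn L μ j1 j2 j3 (N : ℂ) = 0)
    (g : ℤ → ℂ) (k : Fin (N + 1)) :
    ∑ i : Fin (N + 1), g (i : ℕ) * triMat L μ ν j1 j2 j3 N i k =
      Afn L μ j1 j2 j3 ((k : ℕ) : ℂ) * g ((k : ℕ) + 1) -
        (Afn L μ j1 j2 j3 ((k : ℕ) : ℂ) + Cfn L μ j1 j2 j3 ((k : ℕ) : ℂ) - 1 + qp L (-2 * ν)) *
          g (k : ℕ) +
        Cfn L μ j1 j2 j3 ((k : ℕ) : ℂ) * g ((k : ℕ) - 1) := by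
  obtain ⟨k, hk⟩ := k
  have hC : Cfn L μ j1 j2 j3 ((0 : ℕ) : ℂ) = 0 := by simp [Cfn, qp]
  set A := Afn L μ j1 j2 j3 with hAdef
  set C := Cfn L μ j1 j2 j3 with hCdef
  have split : ∀ i : ℕ, g i * (if i + 1 = k then C k else if i = k then -(A k + C k - 1 +
      qp L (-2 * ν)) else if i = k + 1 then A k else 0) =
      (if i + 1 = k then g i * C k else 0) +
      (if i = k then g i * -(A k + C k - 1 + qp L (-2 * ν)) else 0) +
      (if i = k + 1 then g i * A k else 0) := by
    intro i
    split_ifs <;> first | omega | ring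
  simp only [triMat]
  rw [Fin.sum_univ_eq_sum_range (fun i => g i * (if i + 1 = k then C k else if i = k then
    -(A k + C k - 1 + qp L (-2 * ν)) else if i = k + 1 then A k else 0)) (N + 1)]
  simp only [split, Finset.sum_add_distrib]
  have s₁ : ∑ i ∈ Finset.range (N + 1), (if i + 1 = k then g i * C k else 0) =
      C k * g (k - 1) := by
    rcases k with _ | k
    · rw [hC]; simp
    · simp only [add_left_inj]
      rw [Finset.sum_ite_eq' _ _ (fun i : ℕ => g i * C ((k + 1 : ℕ) : ℂ)),
        if_pos (Finset.mem_range.2 (by omega))]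
      push_cast
      rw [add_sub_cancel_right, mul_comm]
  have s₃ : ∑ i ∈ Finset.range (N + 1), (if i = k + 1 then g i * A k else 0) =
      A k * g (k + 1) := by
    rw [Finset.sum_ite_eq' _ _ (fun i : ℕ => g i * A (k : ℂ))]
    split_ifs with h
    · push_cast; ring
    · have : k = N := by rw [Finset.mem_range] at h; omega
      rw [this, hA, zero_mul]
  rw [s₁, s₃, Finset.sum_ite_eq' _ _ (fun i : ℕ => g i * -(A k + C k - 1 + qp L (-2 * ν))),
    if_pos (Finset.mem_range.2 hk)]
  ring

/-- The matrix of values of the `q`-Racah function with row index the spectral variable. -/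
def qRacahMatrix (L μ ν j1 j2 j3 : ℂ) (N : ℕ) : Matrix (Fin (N + 1)) (Fin (N + 1)) ℂ :=
  fun x k => qRacah (Complex.exp L) (-qp L (-2 * μ)) (-qp L (-2 * ν))
    (qp L (1 - j1)) (qp L (1 - j2)) (qp L (1 - j3)) N
    (Complex.exp L ^ (k : ℕ)) (Complex.exp L ^ (x : ℕ))

lemma qRacahMatrix_transpose (L μ ν j1 j2 j3 : ℂ) (N : ℕ) :
    (qRacahMatrix L μ ν j1 j2 j3 N).transpose = qRacahMatrix L ν μ j1 j2 j3 N := by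
  ext x k
  exact qRacah_comm ..

lemma exp_pow_ne_of_lt {L : ℂ} (hq : ∀ n : ℕ, 0 < n → Complex.exp L ^ n ≠ 1) {m n : ℕ}
    (h : m < n) : Complex.exp L ^ m ≠ Complex.exp L ^ n := by
  intro e
  refine hq (n - m) (by omega) ?_
  rw [pow_sub₀ _ (Complex.exp_ne_zero L) h.le, ← e,
    mul_inv_cancel₀ (pow_ne_zero _ (Complex.exp_ne_zero L))]

lemma one_add_qp_ne_zero {L μ : ℂ} {l : ℤ} (h : qp L (2 * μ) ≠ -(Complex.exp L ^ l)) :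
    1 + qp L (-2 * μ) * Complex.exp L ^ l ≠ 0 := by
  contrapose! h
  have h' : qp L (-2 * μ) = (qp L (2 * μ))⁻¹ := by rw [← qp_neg]; congr 1; ring
  rw [h'] at h
  have := qp_ne_zero L (2 * μ)
  field_simp at h
  linear_combination h

lemma qRacahDenom_exp_ne_zero {L j1 j2 j3 : ℂ} (hq : ∀ n : ℕ, 0 < n → Complex.exp L ^ n ≠ 1)
    {N : ℕ} (hj : ∀ k : ℕ, 1 ≤ k → k ≤ N → qp L j1 ≠ Complex.exp L ^ k ∧
      qp L j2 ≠ Complex.exp L ^ k ∧ qp L j3 ≠ Complex.exp L ^ k) :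
    qRacahDenom (Complex.exp L) (qp L (1 - j1)) (qp L (1 - j2)) (qp L (1 - j3)) N ≠ 0 := by
  have key : ∀ (j : ℂ) (h : ℕ), qp L j ≠ Complex.exp L ^ (h + 1) →
      1 - qp L (1 - j) * Complex.exp L ^ h ≠ 0 := by
    intro j h hne e
    apply hne
    rw [qp_sub, qp_one] at e
    have := qp_ne_zero L j
    field_simp at e
    rw [pow_succ']
    linear_combination e
  refine Finset.prod_ne_zero_iff.2 fun h hh => ?_
  rw [Finset.mem_range] at hh
  obtain ⟨h₁, h₂, h₃⟩ := hj (h + 1) (by omega) (by omega)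
  refine div_ne_zero (mul_ne_zero (mul_ne_zero (mul_ne_zero ?_ (key _ _ h₁)) (key _ _ h₂))
    (key _ _ h₃)) (Complex.exp_ne_zero L)
  rw [← pow_succ', sub_ne_zero]
  exact (hq _ h.succ_pos).symm

lemma Afn_natCast_eq_zero {L j1 j2 j3 : ℂ} {N : ℕ} (μ : ℂ)
    (hfin : qp L j1 = qp L ((N : ℂ) + 1) ∨ qp L j2 = qp L ((N : ℂ) + 1) ∨
      qp L j3 = qp L ((N : ℂ) + 1)) :
    Afn L μ j1 j2 j3 (N : ℂ) = 0 := by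
  have key : ∀ j : ℂ, qp L j = qp L ((N : ℂ) + 1) → 1 - qp L ((N : ℂ) - j + 1) = 0 := by
    intro j hj
    have : (N : ℂ) - j + 1 = (N + 1) - j := by ring
    rw [this, qp_sub, hj, div_self (qp_ne_zero _ _), sub_self]
  rcases hfin with h | h | h <;> simp [Afn, key _ h]

lemma qRacahMatrix_mul_triMat {L : ℂ} (hq : ∀ n : ℕ, 0 < n → Complex.exp L ^ n ≠ 1)
    {N : ℕ} {μ j1 j2 j3 ν : ℂ} (hν : ν = -μ - 1 + (j1 + j2 + j3) / 2)
    (hμ2 : ∀ l : ℤ, -1 ≤ l → l ≤ 2 * (N : ℤ) + 1 → qp L (2 * μ) ≠ -(Complex.exp L ^ l))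
    (hfin : qp L j1 = qp L ((N : ℂ) + 1) ∨ qp L j2 = qp L ((N : ℂ) + 1) ∨
      qp L j3 = qp L ((N : ℂ) + 1))
    (hj : ∀ k : ℕ, 1 ≤ k → k ≤ N → qp L j1 ≠ Complex.exp L ^ k ∧
      qp L j2 ≠ Complex.exp L ^ k ∧ qp L j3 ≠ Complex.exp L ^ k) :
    qRacahMatrix L μ ν j1 j2 j3 N * triMat L μ ν j1 j2 j3 N =
      Matrix.diagonal (fun k : Fin (N + 1) =>
        qp L (-((k : ℕ) : ℂ)) - qp L (-2 * ν + ((k : ℕ) : ℂ))) *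
        qRacahMatrix L μ ν j1 j2 j3 N := by
  ext x k
  have hq0 := Complex.exp_ne_zero L
  rw [Matrix.diagonal_mul, Matrix.mul_apply]
  have hs := sum_mul_triMat (ν := ν) (Afn_natCast_eq_zero μ hfin)
    (fun m => qRacah (Complex.exp L) (-qp L (-2 * μ)) (-qp L (-2 * ν))
      (qp L (1 - j1)) (qp L (1 - j2)) (qp L (1 - j3)) N
      (Complex.exp L ^ m) (Complex.exp L ^ (x : ℕ))) k
  simp only [zpow_natCast, zpow_add₀ hq0, zpow_sub₀ hq0, zpow_one] at hs
  have hk := k.isLt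
  have hd : ∀ l : ℤ, -1 ≤ l → l ≤ 2 * (N : ℤ) + 1 →
      1 + qp L (-2 * μ) * Complex.exp L ^ l ≠ 0 :=
    fun l h h' => one_add_qp_ne_zero (hμ2 l h h')
  have hd₀ := hd (2 * (k : ℕ) - 1) (by omega) (by omega)
  have hd₁ := hd (2 * (k : ℕ)) (by omega) (by omega)
  have hd₂ := hd (2 * (k : ℕ) + 1) (by omega) (by omega)
  have hsq : Complex.exp L ^ (2 * ((k : ℕ) : ℤ)) = (Complex.exp L ^ (k : ℕ)) ^ 2 := by
    rw [mul_comm, zpow_mul, zpow_natCast]; rfl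
  simp only [zpow_sub₀ hq0, zpow_add₀ hq0, zpow_one, hsq] at hd₀ hd₁ hd₂
  have hc : -qp L (-2 * ν) = qp L (1 - j1) * qp L (1 - j2) * qp L (1 - j3) /
      (-qp L (-2 * μ) * Complex.exp L) := by
    rw [neg_mul (qp L (-2 * μ)), div_neg, ← qp_one L, ← qp_add, ← qp_add, ← qp_add, ← qp_sub, hν]
    congr 2; ring
  have hrec := qRacah_recurrence_truncated hq0 (pow_ne_zero (k : ℕ) hq0)
    (pow_ne_zero (x : ℕ) hq0) (neg_ne_zero.2 (qp_ne_zero L (-2 * μ))) (qp_ne_zero L (1 - j1))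
    (qp_ne_zero L (1 - j2)) (qp_ne_zero L (1 - j3)) hc
    (fun h => hd₀ (by
      rw [← mul_div_assoc, one_add_div hq0, div_eq_zero_iff]
      exact Or.inl (by linear_combination h)))
    (fun h => hd₁ (by linear_combination h)) (fun h => hd₂ (by linear_combination h)) N
    (qRacahDenom_exp_ne_zero hq hj)
  rw [qRacahFactor_pow_eq_zero hq0 _ x.isLt, mul_zero, zero_div, add_zero] at hrec
  rw [Afn_eq_qRacahUp, Cfn_eq_qRacahDown hν] at hs
  simp only [qRacahMatrix]
  rw [hs, qp_neg, qp_add, qp_natCast]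
  linear_combination hrec

lemma spectrum_injective {L : ℂ} (hq : ∀ n : ℕ, 0 < n → Complex.exp L ^ n ≠ 1)
    {N : ℕ} {ν : ℂ}
    (hν2 : ∀ l : ℤ, -1 ≤ l → l ≤ 2 * (N : ℤ) + 1 → qp L (2 * ν) ≠ -(Complex.exp L ^ l)) :
    Function.Injective (fun k : Fin (N + 1) =>
      qp L (-((k : ℕ) : ℂ)) - qp L (-2 * ν + ((k : ℕ) : ℂ))) := by
  have key : ∀ x y : Fin (N + 1), x < y →
      qp L (-((x : ℕ) : ℂ)) - qp L (-2 * ν + ((x : ℕ) : ℂ)) ≠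
        qp L (-((y : ℕ) : ℂ)) - qp L (-2 * ν + ((y : ℕ) : ℂ)) := by
    intro x y hxy e
    have h₁ := one_add_qp_ne_zero (hν2 ((x : ℕ) + (y : ℕ)) (by omega) (by omega))
    have h₂ := exp_pow_ne_of_lt hq (Fin.lt_def.1 hxy)
    rw [zpow_add₀ (Complex.exp_ne_zero L), zpow_natCast, zpow_natCast] at h₁
    rw [qp_neg, qp_neg, qp_add, qp_add, qp_natCast, qp_natCast] at e
    have hx := pow_ne_zero (x : ℕ) (Complex.exp_ne_zero L)
    have hy := pow_ne_zero (y : ℕ) (Complex.exp_ne_zero L)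
    refine mul_ne_zero (sub_ne_zero.2 h₂) h₁ ?_
    generalize qp L (-2 * ν) = p at h₁ e ⊢
    field_simp at e
    linear_combination -e
  intro x y e
  rcases lt_trichotomy x y with h | h | h
  · exact absurd e (key x y h)
  · exact h
  · exact absurd e.symm (key y x h)

/-- A matrix with nonzero rows that are left eigenvectors for distinct eigenvalues is
invertible. -/
lemma isUnit_of_mul_eq_diagonal_mul {n : Type*} [Fintype n] [DecidableEq n]
    {S M : Matrix n n ℂ} {d : n → ℂ} (hd : Function.Injective d)
    (h : S * M = Matrix.diagonal d * S) (hS : ∀ x, S x ≠ 0) : IsUnit S := by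
  rw [← Matrix.linearIndependent_rows_iff_isUnit]
  refine Module.End.eigenvectors_linearIndependent' (Matrix.vecMulLinear M) d hd _ fun x => ?_
  rw [Module.End.hasEigenvector_iff, Module.End.mem_eigenspace_iff]
  refine ⟨?_, hS x⟩
  ext k
  have := congrFun (congrFun h x) k
  rw [Matrix.diagonal_mul] at this
  simpa [Matrix.mul_apply, Matrix.vecMul, dotProduct] using this

lemma Afn_ne_zero {L : ℂ} {N : ℕ} {μ j1 j2 j3 : ℂ}
    (hμ2 : ∀ l : ℤ, -1 ≤ l → l ≤ 2 * (N : ℤ) + 1 → qp L (2 * μ) ≠ -(Complex.exp L ^ l))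
    {k : ℕ} (hk : k < N) (hj : qp L j1 ≠ Complex.exp L ^ (k + 1) ∧
      qp L j2 ≠ Complex.exp L ^ (k + 1) ∧ qp L j3 ≠ Complex.exp L ^ (k + 1)) :
    Afn L μ j1 j2 j3 (k : ℂ) ≠ 0 := by
  have key : ∀ j : ℂ, qp L j ≠ Complex.exp L ^ (k + 1) → 1 - qp L ((k : ℂ) - j + 1) ≠ 0 := by
    intro j hj e
    apply hj
    have e' : (k : ℂ) - j + 1 = ((k + 1 : ℕ) : ℂ) - j := by push_cast; ring
    have := qp_ne_zero L j
    rw [e', qp_sub, qp_natCast] at e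
    field_simp at e
    linear_combination e
  have hd : ∀ l : ℕ, l ≤ 2 * N + 1 → 1 + qp L (-2 * μ + (l : ℂ)) ≠ 0 := by
    intro l hl
    have := one_add_qp_ne_zero (hμ2 l (by omega) (by omega))
    rwa [zpow_natCast, ← qp_natCast, ← qp_add] at this
  have d₁ := hd (2 * k) (by omega)
  have d₂ := hd (2 * k + 1) (by omega)
  push_cast [← add_assoc] at d₁ d₂
  exact div_ne_zero (mul_ne_zero (mul_ne_zero (mul_ne_zero (key _ hj.1) (key _ hj.2.1))
    (key _ hj.2.2)) (hd k (by omega))) (mul_ne_zero d₁ d₂)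

lemma Cfn_ne_zero {L : ℂ} (hq : ∀ n : ℕ, 0 < n → Complex.exp L ^ n ≠ 1) {N : ℕ}
    {μ j1 j2 j3 : ℂ}
    (hμ2 : ∀ l : ℤ, -1 ≤ l → l ≤ 2 * (N : ℤ) + 1 → qp L (2 * μ) ≠ -(Complex.exp L ^ l))
    {k : ℕ} (hk : 1 ≤ k) (hkN : k ≤ N) (hj : LamF L μ j1 ≠ LamF L μ (k : ℂ) ∧
      LamF L μ j2 ≠ LamF L μ (k : ℂ) ∧ LamF L μ j3 ≠ LamF L μ (k : ℂ)) :
    Cfn L μ j1 j2 j3 (k : ℂ) ≠ 0 := by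
  have key : ∀ j : ℂ, LamF L μ j ≠ LamF L μ (k : ℂ) → 1 + qp L (-2 * μ - 1 + k + j) ≠ 0 :=
    fun j hj e => hj (LamF_eq_of_qp_eq_neg_one (by linear_combination e))
  have hd : ∀ l : ℕ, l ≤ 2 * N + 1 → 1 + qp L (-2 * μ + (l : ℂ)) ≠ 0 := by
    intro l hl
    have := one_add_qp_ne_zero (hμ2 l (by omega) (by omega))
    rwa [zpow_natCast, ← qp_natCast, ← qp_add] at this
  have d₁ := hd (2 * k - 1) (by omega)
  have d₂ := hd (2 * k) (by omega)
  rw [Nat.cast_sub (by omega)] at d₁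
  push_cast [← add_sub_assoc] at d₁ d₂
  have h₀ : 1 - qp L (k : ℂ) ≠ 0 := by
    rw [qp_natCast, sub_ne_zero]
    exact (hq k hk).symm
  exact div_ne_zero (mul_ne_zero (mul_ne_zero (mul_ne_zero (mul_ne_zero
    (neg_ne_zero.2 (qp_ne_zero _ _)) h₀) (key _ hj.1)) (key _ hj.2.1)) (key _ hj.2.2))
    (mul_ne_zero d₁ d₂)

/-- An irreducible tridiagonal matrix is diagonally similar to its transpose. -/
lemma triMat_transpose_mul_diagonal {L μ ν j1 j2 j3 : ℂ} {N : ℕ}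
    (hA : ∀ k < N, Afn L μ j1 j2 j3 (k : ℂ) ≠ 0)
    (hC : ∀ k < N, Cfn L μ j1 j2 j3 ((k + 1 : ℕ) : ℂ) ≠ 0) :
    ∃ w : Fin (N + 1) → ℂ, (∀ k, w k ≠ 0) ∧
      (triMat L μ ν j1 j2 j3 N).transpose * Matrix.diagonal w =
        Matrix.diagonal w * triMat L μ ν j1 j2 j3 N := by
  let W : ℕ → ℂ := fun k => ∏ h ∈ Finset.range k,
    (Cfn L μ j1 j2 j3 ((h + 1 : ℕ) : ℂ) / Afn L μ j1 j2 j3 (h : ℂ))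
  have hW : ∀ k < N, Afn L μ j1 j2 j3 (k : ℂ) * W (k + 1) =
      W k * Cfn L μ j1 j2 j3 ((k + 1 : ℕ) : ℂ) := by
    intro k hk
    have := hA k hk
    simp only [W, Finset.prod_range_succ]
    field_simp
  refine ⟨fun k => W k, fun k => Finset.prod_ne_zero_iff.2 fun h hh => ?_, ?_⟩
  · have : h < N := by have := k.isLt; rw [Finset.mem_range] at hh; omega
    exact div_ne_zero (hC h this) (hA h this)
  · ext i k
    rw [Matrix.mul_diagonal, Matrix.diagonal_mul, Matrix.transpose_apply]
    obtain ⟨i, hi⟩ := i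
    obtain ⟨k, hk⟩ := k
    rcases eq_or_ne i k with rfl | hik
    · exact mul_comm _ _
    rcases eq_or_ne (i + 1) k with rfl | h₁
    · have : i + 1 + 1 ≠ i := by omega
      simpa [triMat, this] using hW i (by omega)
    rcases eq_or_ne (k + 1) i with rfl | h₂
    · have : k + 1 + 1 ≠ k := by omega
      simpa [triMat, this, mul_comm] using (hW k (by omega)).symm
    · simp [triMat, h₁, h₂, hik, hik.symm, h₁.symm, h₂.symm]

/-- the pair of matrices `M_A` (tridiagonal, built from `A_n, C_n` and
`q^{−2ν}`) and `M_B = diag(q^{−k} − q^{−2μ+k})` is simultaneously conjugate, by a single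
invertible matrix `P`, to the pair `diag(q^{−k} − q^{−2ν+k})` and the tridiagonal matrix
built from `B_n, D_n` and `q^{−2μ}`; in particular `(M_A, M_B)` is a Leonard pair. -/
theorem leonard_pair_conjugation (L : ℂ)
    (hq : ∀ n : ℕ, 0 < n → Complex.exp L ^ n ≠ 1)
    (N : ℕ) (μ j1 j2 j3 ν : ℂ)
    (hν : ν = -μ - 1 + (j1 + j2 + j3) / 2)
    (hμ2 : ∀ l : ℤ, -1 ≤ l → l ≤ 2 * (N : ℤ) + 1 →
      qp L (2 * μ) ≠ -(Complex.exp L ^ l))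
    (hν2 : ∀ l : ℤ, -1 ≤ l → l ≤ 2 * (N : ℤ) + 1 →
      qp L (2 * ν) ≠ -(Complex.exp L ^ l))
    (hfin : qp L j1 = qp L ((N : ℂ) + 1) ∨ qp L j2 = qp L ((N : ℂ) + 1) ∨
      qp L j3 = qp L ((N : ℂ) + 1))
    (hirrμ : ∀ k : ℕ, 1 ≤ k → k ≤ N →
      LamF L μ j1 ≠ LamF L μ (k : ℂ) ∧ LamF L μ j2 ≠ LamF L μ (k : ℂ) ∧
      LamF L μ j3 ≠ LamF L μ (k : ℂ))
    (hirrν : ∀ k : ℕ, 1 ≤ k → k ≤ N →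
      LamF L ν j1 ≠ LamF L ν (k : ℂ) ∧ LamF L ν j2 ≠ LamF L ν (k : ℂ) ∧
      LamF L ν j3 ≠ LamF L ν (k : ℂ)) :
    ∃ P : Matrix (Fin (N + 1)) (Fin (N + 1)) ℂ, IsUnit P ∧
      P⁻¹ * triMat L μ ν j1 j2 j3 N * P =
        Matrix.diagonal (fun k : Fin (N + 1) =>
          qp L (-((k : ℕ) : ℂ)) - qp L (-2 * ν + ((k : ℕ) : ℂ))) ∧
      P⁻¹ * Matrix.diagonal (fun k : Fin (N + 1) =>
          qp L (-((k : ℕ) : ℂ)) - qp L (-2 * μ + ((k : ℕ) : ℂ))) * P =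
        triMat L ν μ j1 j2 j3 N := by
  have hexp : ∀ k : ℕ, Complex.exp L ^ k = qp L (k : ℂ) := fun k => (qp_natCast L k).symm
  have hj : ∀ k : ℕ, 1 ≤ k → k ≤ N → qp L j1 ≠ Complex.exp L ^ k ∧
      qp L j2 ≠ Complex.exp L ^ k ∧ qp L j3 ≠ Complex.exp L ^ k := by
    intro k hk hkN
    rw [hexp]
    obtain ⟨h₁, h₂, h₃⟩ := hirrμ k hk hkN
    exact ⟨fun h => h₁ (LamF_congr h), fun h => h₂ (LamF_congr h), fun h => h₃ (LamF_congr h)⟩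
  have hμ : μ = -ν - 1 + (j1 + j2 + j3) / 2 := by rw [hν]; ring
  obtain ⟨w, hw, hT⟩ := triMat_transpose_mul_diagonal (L := L) (μ := ν) (ν := μ) (j1 := j1)
    (j2 := j2) (j3 := j3) (N := N)
    (fun k hk => Afn_ne_zero hν2 hk (hj (k + 1) (by omega) (by omega)))
    (fun k hk => Cfn_ne_zero hq hν2 (by omega) (by omega) (hirrν (k + 1) (by omega) (by omega)))
  have hS₁ := qRacahMatrix_mul_triMat hq hν hμ2 hfin hj
  have hS₂ := congrArg Matrix.transpose (qRacahMatrix_mul_triMat hq hμ hν2 hfin hj)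
  rw [Matrix.transpose_mul, Matrix.transpose_mul, Matrix.diagonal_transpose,
    qRacahMatrix_transpose] at hS₂
  have hS : IsUnit (qRacahMatrix L μ ν j1 j2 j3 N) := by
    refine isUnit_of_mul_eq_diagonal_mul (spectrum_injective hq hν2) hS₁ fun x h => ?_
    have := congrFun h 0
    simp [qRacahMatrix, qRacah_one_left] at this
  have hW : IsUnit (Matrix.diagonal w) :=
    Matrix.isUnit_diagonal.2 (Pi.isUnit_iff.2 fun k => (hw k).isUnit)
  generalize qRacahMatrix L μ ν j1 j2 j3 N = S at hS₁ hS₂ hS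
  have hSd := (Matrix.isUnit_iff_isUnit_det S).1 hS
  have hWd := (Matrix.isUnit_iff_isUnit_det _).1 hW
  refine ⟨S⁻¹ * Matrix.diagonal w, (Matrix.isUnit_nonsing_inv_iff.2 hS).mul hW, ?_, ?_⟩
  · rw [Matrix.mul_inv_rev, Matrix.nonsing_inv_nonsing_inv S hSd, Matrix.mul_assoc _ S, hS₁,
      Matrix.mul_assoc, Matrix.mul_assoc, Matrix.mul_nonsing_inv_cancel_left _ _ hSd,
      (Matrix.commute_diagonal _ _).eq, Matrix.nonsing_inv_mul_cancel_left _ _ hWd]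
  · rw [Matrix.mul_inv_rev, Matrix.nonsing_inv_nonsing_inv S hSd, Matrix.mul_assoc _ S, ← hS₂,
      Matrix.mul_assoc, Matrix.mul_assoc, Matrix.mul_nonsing_inv_cancel_left _ _ hSd, hT,
      Matrix.nonsing_inv_mul_cancel_left _ _ hWd]
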